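/- arXiv:1301.3550 — 2 statements merged into one kernel-verified Lean document; each statement's English description precedes it below -/
import Mathlib

section
/- For all x, y ∈ R, setting A = yx² − [2]_q·xyx + x²y, one has the identity yx⁴ − [4]_q·xyx³ + (q² + q⁻²)[3]_q·x²yx² − [4]_q·x³yx + x⁴y = Ax² − (q³ + q⁻³)·xAx + x²A, where (q² + q⁻²)[3]_q equals [4]_q[3]_q/[2]_q whenever [2]_q is invertible. In particular, if A = 0 then the degree-4 quantum Serre expression yx⁴ − [4]_q·xyx³ + (q² + q⁻²)[3]_q·x²yx² − [4]_q·x³yx + x⁴y vanishes, i.e. the quantum Serre relation for a_{ij} = −3 follows from the lower-degree relation A = 0. -/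
/-- For `A = yx² − [2]_q·xyx + x²y` one has
`yx⁴ − [4]_q·xyx³ + (q²+q⁻²)[3]_q·x²yx² − [4]_q·x³yx + x⁴y = Ax² − (q³+q⁻³)·xAx + x²A`,
where `(q²+q⁻²)[3]_q = [4]_q[3]_q/[2]_q` whenever `[2]_q` is invertible; in particular if
`A = 0` then the degree-4 quantum Serre expression (the case `a_{ij} = −3`) vanishes. -/
theorem serre_degree_four_from_lower
    (K : Type*) [CommRing K] (q : K) [Invertible q]
    (R : Type*) [Ring R] [Algebra K R] (x y : R)
    (A : R) (hA : A = y * x ^ 2 - (q + ⅟q) • (x * y * x) + x ^ 2 * y) :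
    (y * x ^ 4 - (q ^ 3 + q + ⅟q + ⅟q ^ 3) • (x * y * x ^ 3)
        + ((q ^ 2 + ⅟q ^ 2) * (q ^ 2 + 1 + ⅟q ^ 2)) • (x ^ 2 * y * x ^ 2)
        - (q ^ 3 + q + ⅟q + ⅟q ^ 3) • (x ^ 3 * y * x) + x ^ 4 * y
      = A * x ^ 2 - (q ^ 3 + ⅟q ^ 3) • (x * A * x) + x ^ 2 * A) ∧
    (∀ _ : Invertible (q + ⅟q),
      (q ^ 2 + ⅟q ^ 2) * (q ^ 2 + 1 + ⅟q ^ 2)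
        = (q ^ 3 + q + ⅟q + ⅟q ^ 3) * (q ^ 2 + 1 + ⅟q ^ 2) * ⅟(q + ⅟q)) ∧
    (A = 0 →
      y * x ^ 4 - (q ^ 3 + q + ⅟q + ⅟q ^ 3) • (x * y * x ^ 3)
        + ((q ^ 2 + ⅟q ^ 2) * (q ^ 2 + 1 + ⅟q ^ 2)) • (x ^ 2 * y * x ^ 2)
        - (q ^ 3 + q + ⅟q + ⅟q ^ 3) • (x ^ 3 * y * x) + x ^ 4 * y = 0) := by
  have hq : q * ⅟q = 1 := mul_invOf_self q
  generalize ⅟q = p at *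
  have identity : y * x ^ 4 - (q ^ 3 + q + p + p ^ 3) • (x * y * x ^ 3)
        + ((q ^ 2 + p ^ 2) * (q ^ 2 + 1 + p ^ 2)) • (x ^ 2 * y * x ^ 2)
        - (q ^ 3 + q + p + p ^ 3) • (x ^ 3 * y * x) + x ^ 4 * y
      = A * x ^ 2 - (q ^ 3 + p ^ 3) • (x * A * x) + x ^ 2 * A := by
    have hc : (q ^ 2 + p ^ 2) * (q ^ 2 + 1 + p ^ 2) = 2 + (q + p) * (q ^ 3 + p ^ 3) := by
      linear_combination (2 * q * p + 2 - q ^ 2 - p ^ 2) * hq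
    rw [hc, hA]
    simp only [pow_succ, pow_zero, one_mul, mul_add, add_mul, mul_sub, sub_mul, mul_smul_comm,
      smul_mul_assoc, ← mul_assoc]
    module
  refine ⟨identity, fun hinv => ?_, fun h => ?_⟩
  · rw [eq_comm, mul_invOf_eq_iff_eq_mul_right]
    linear_combination (-(q + p) * (q ^ 2 + 1 + p ^ 2)) * hq
  · rw [identity, h]
    simp
end

section
/- There is a unique Hopf algebra structure on U_q over K whose comultiplication Δ, counit ε and antipode S satisfy, for all i ∈ Î: Δ(E_i) = E_i ⊗ K_i^{−1} + 1 ⊗ E_i, Δ(F_i) = F_i ⊗ 1 + K_i ⊗ F_i, Δ(K_i) = K_i ⊗ K_i, Δ(γ^{1/2}) = γ^{1/2} ⊗ γ^{1/2}, ε(E_i) = 0, ε(F_i) = 0, ε(K_i) = 1, ε(γ^{1/2}) = 1, S(E_i) = −E_i K_i, S(F_i) = −K_i^{−1} F_i, S(K_i) = K_i^{−1}, and S(γ^{1/2}) = γ^{−1/2}. -/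
open scoped BigOperators TensorProduct

noncomputable section

/-- The base field `K = ℚ(q)` of rational functions over `ℚ`. -/
abbrev Kq : Type := RatFunc ℚ

/-- The element `q ∈ ℚ(q)`. -/
def qvar : Kq := RatFunc.X

/-- Generators of the quantum affine algebra: `E_i`, `F_i`, `K_i`, `K_i⁻¹`, `γ^{1/2}`,
`γ^{-1/2}`. -/
inductive Gen (n : ℕ) : Type
  | E : Fin n → Gen n
  | F : Fin n → Gen n
  | K : Fin n → Gen n
  | Kinv : Fin n → Gen n
  | g : Gen n
  | ginv : Gen n

variable {n : ℕ}

/-- The free algebra on the generators. -/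
abbrev FA (n : ℕ) : Type := FreeAlgebra Kq (Gen n)

/-- Inclusion of the generators into the free algebra. -/
def ι : Gen n → FA n := FreeAlgebra.ι Kq

/-- `q_i = q^{d_i}`. -/
def qi (d : Fin n → ℕ) (i : Fin n) : Kq := qvar ^ (d i)

/-- The quantum integer `[m]_i = (q_i^m - q_i^{-m})/(q_i - q_i⁻¹)`. -/
def qint (d : Fin n → ℕ) (i : Fin n) (m : ℤ) : Kq :=
  (qi d i ^ m - qi d i ^ (-m)) / (qi d i - (qi d i)⁻¹)

/-- The quantum factorial `[m]_i!`. -/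
def qfact (d : Fin n → ℕ) (i : Fin n) : ℕ → Kq
  | 0 => 1
  | m + 1 => qfact d i m * qint d i (m + 1)

/-- The quantum binomial coefficient `[m choose s]_i`. -/
def qbinom (d : Fin n → ℕ) (i : Fin n) (m s : ℕ) : Kq :=
  qfact d i m / (qfact d i s * qfact d i (m - s))

/-- The quantum Serre element `∑_{s=0}^{1-a_{ij}} (-1)^s [1-a_{ij} choose s]_i
E_i^{1-a_{ij}-s} E_j E_i^s` in the free algebra. -/
def serreE (a : Fin n → Fin n → ℤ) (d : Fin n → ℕ) (i j : Fin n) : FA n :=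
  ∑ s ∈ Finset.range ((1 - a i j).toNat + 1),
    ((-1 : Kq) ^ s * qbinom d i (1 - a i j).toNat s) •
      (ι (Gen.E i) ^ ((1 - a i j).toNat - s) * ι (Gen.E j) * ι (Gen.E i) ^ s)

/-- The quantum Serre element in the `F`'s. -/
def serreF (a : Fin n → Fin n → ℤ) (d : Fin n → ℕ) (i j : Fin n) : FA n :=
  ∑ s ∈ Finset.range ((1 - a i j).toNat + 1),
    ((-1 : Kq) ^ s * qbinom d i (1 - a i j).toNat s) •
      (ι (Gen.F i) ^ ((1 - a i j).toNat - s) * ι (Gen.F j) * ι (Gen.F i) ^ s)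

/-- The defining relations of the quantum affine algebra `U_q`. -/
inductive QRel (a : Fin n → Fin n → ℤ) (d r : Fin n → ℕ) : FA n → FA n → Prop
  | KKinv (i : Fin n) : QRel a d r (ι (Gen.K i) * ι (Gen.Kinv i)) 1
  | KinvK (i : Fin n) : QRel a d r (ι (Gen.Kinv i) * ι (Gen.K i)) 1
  | gginv : QRel a d r (ι Gen.g * ι Gen.ginv) 1
  | ginvg : QRel a d r (ι Gen.ginv * ι Gen.g) 1
  | gcomm (x : Gen n) : QRel a d r (ι Gen.g * ι x) (ι x * ι Gen.g)
  | gsq : QRel a d r (ι Gen.g * ι Gen.g)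
      (((List.finRange n).map fun i => ι (Gen.K i) ^ r i).prod)
  | KK (i j : Fin n) : QRel a d r (ι (Gen.K i) * ι (Gen.K j)) (ι (Gen.K j) * ι (Gen.K i))
  | KE (i j : Fin n) : QRel a d r (ι (Gen.K i) * ι (Gen.E j))
      ((qi d i ^ (a i j)) • (ι (Gen.E j) * ι (Gen.K i)))
  | KF (i j : Fin n) : QRel a d r (ι (Gen.K i) * ι (Gen.F j))
      ((qi d i ^ (-(a i j))) • (ι (Gen.F j) * ι (Gen.K i)))
  | EF (i j : Fin n) : QRel a d r (ι (Gen.E i) * ι (Gen.F j) - ι (Gen.F j) * ι (Gen.E i))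
      (if i = j then ((qi d i - (qi d i)⁻¹)⁻¹) • (ι (Gen.K i) - ι (Gen.Kinv i)) else 0)
  | serreEE (i j : Fin n) (h : i ≠ j) : QRel a d r (serreE a d i j) 0
  | serreFF (i j : Fin n) (h : i ≠ j) : QRel a d r (serreF a d i j) 0

/-- The quantum affine algebra `U_q`, presented by the generators and relations above. -/
abbrev Uq (a : Fin n → Fin n → ℤ) (d r : Fin n → ℕ) : Type := RingQuot (QRel a d r)

/-- The images of the generators in `U_q`. -/
def gen (a : Fin n → Fin n → ℤ) (d r : Fin n → ℕ) (x : Gen n) : Uq a d r :=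
  RingQuot.mkAlgHom Kq (QRel a d r) (ι x)

/-- The hypotheses on the Cartan data: `A = (a_{ij})` is a symmetrizable generalized Cartan
matrix with symmetrizing positive integers `d_i`, and the positive integers `r_i` satisfy
`∑_i r_i d_i a_{ij} = 0` for all `j`. -/
structure CartanData (n : ℕ) (a : Fin n → Fin n → ℤ) (d r : Fin n → ℕ) : Prop where
  diag : ∀ i, a i i = 2
  offdiag : ∀ i j, i ≠ j → a i j ≤ 0
  zero_iff : ∀ i j, a i j = 0 ↔ a j i = 0
  symmetrizable : ∀ i j, (d i : ℤ) * a i j = (d j : ℤ) * a j i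
  d_pos : ∀ i, 0 < d i
  r_pos : ∀ i, 0 < r i
  null : ∀ j, ∑ i, (r i : ℤ) * (d i : ℤ) * a i j = 0

/-- A Hopf algebra structure `(Δ, ε, S)` on `U_q` (over the fixed algebra structure),
together with the prescribed values on the generators:
`Δ(E_i) = E_i ⊗ K_i⁻¹ + 1 ⊗ E_i`, `Δ(F_i) = F_i ⊗ 1 + K_i ⊗ F_i`, `Δ(K_i) = K_i ⊗ K_i`,
`Δ(γ^{1/2}) = γ^{1/2} ⊗ γ^{1/2}`, `ε(E_i) = ε(F_i) = 0`, `ε(K_i) = ε(γ^{1/2}) = 1`,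
`S(E_i) = -E_i K_i`, `S(F_i) = -K_i⁻¹ F_i`, `S(K_i) = K_i⁻¹`, `S(γ^{1/2}) = γ^{-1/2}`. -/
def HopfProp (a : Fin n → Fin n → ℤ) (d r : Fin n → ℕ)
    (Δ : Uq a d r →ₗ[Kq] (Uq a d r ⊗[Kq] Uq a d r))
    (ε : Uq a d r →ₗ[Kq] Kq)
    (S : Uq a d r →ₗ[Kq] Uq a d r) : Prop :=
  -- coassociativity
  (∀ x, (TensorProduct.assoc Kq (Uq a d r) (Uq a d r) (Uq a d r))
      ((Δ.rTensor (Uq a d r)) (Δ x)) = (Δ.lTensor (Uq a d r)) (Δ x)) ∧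
  -- counit axioms
  (∀ x, (TensorProduct.lid Kq (Uq a d r)) ((ε.rTensor (Uq a d r)) (Δ x)) = x) ∧
  (∀ x, (TensorProduct.rid Kq (Uq a d r)) ((ε.lTensor (Uq a d r)) (Δ x)) = x) ∧
  -- `Δ` and `ε` are algebra homomorphisms
  Δ 1 = 1 ⊗ₜ[Kq] 1 ∧
  (∀ x y, Δ (x * y) = Δ x * Δ y) ∧
  ε 1 = 1 ∧
  (∀ x y, ε (x * y) = ε x * ε y) ∧
  -- antipode axioms
  (∀ x, LinearMap.mul' Kq (Uq a d r) ((S.rTensor (Uq a d r)) (Δ x))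
      = algebraMap Kq (Uq a d r) (ε x)) ∧
  (∀ x, LinearMap.mul' Kq (Uq a d r) ((S.lTensor (Uq a d r)) (Δ x))
      = algebraMap Kq (Uq a d r) (ε x)) ∧
  -- values on the generators
  (∀ i, Δ (gen a d r (Gen.E i))
      = gen a d r (Gen.E i) ⊗ₜ[Kq] gen a d r (Gen.Kinv i) + 1 ⊗ₜ[Kq] gen a d r (Gen.E i)) ∧
  (∀ i, Δ (gen a d r (Gen.F i))
      = gen a d r (Gen.F i) ⊗ₜ[Kq] 1 + gen a d r (Gen.K i) ⊗ₜ[Kq] gen a d r (Gen.F i)) ∧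
  (∀ i, Δ (gen a d r (Gen.K i)) = gen a d r (Gen.K i) ⊗ₜ[Kq] gen a d r (Gen.K i)) ∧
  Δ (gen a d r Gen.g) = gen a d r Gen.g ⊗ₜ[Kq] gen a d r Gen.g ∧
  (∀ i, ε (gen a d r (Gen.E i)) = 0) ∧
  (∀ i, ε (gen a d r (Gen.F i)) = 0) ∧
  (∀ i, ε (gen a d r (Gen.K i)) = 1) ∧
  ε (gen a d r Gen.g) = 1 ∧
  (∀ i, S (gen a d r (Gen.E i)) = -(gen a d r (Gen.E i) * gen a d r (Gen.K i))) ∧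
  (∀ i, S (gen a d r (Gen.F i)) = -(gen a d r (Gen.Kinv i) * gen a d r (Gen.F i))) ∧
  (∀ i, S (gen a d r (Gen.K i)) = gen a d r (Gen.Kinv i)) ∧
  S (gen a d r Gen.g) = gen a d r Gen.ginv

/-- The quantum Serre expression in two elements of an arbitrary algebra. -/
def serrePoly {B : Type*} [Ring B] [Algebra Kq B] (d : Fin n → ℕ) (i : Fin n) (N : ℕ)
    (x z : B) : B :=
  ∑ s ∈ Finset.range (N + 1), ((-1 : Kq) ^ s * qbinom d i N s) • (x ^ (N - s) * z * x ^ s)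

/-- Iterated `q`-commutators: `z`, then `y ↦ x y - t p^{2k} y x` at the `k`-th step. -/
def qcommSeq {B : Type*} [Ring B] [Algebra Kq B] (p t : Kq) (x z : B) : ℕ → B
  | 0 => z
  | k + 1 => x * qcommSeq p t x z k - (t * p ^ (2 * k)) • (qcommSeq p t x z k * x)

section QuantumIntegers

lemma qvar_ne_zero : qvar ≠ 0 := RatFunc.X_ne_zero

lemma qvar_pow_ne_one {k : ℕ} (hk : 0 < k) : qvar ^ k ≠ 1 := by
  intro h
  have h1 : algebraMap (Polynomial ℚ) (RatFunc ℚ) (Polynomial.X ^ k)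
      = algebraMap (Polynomial ℚ) (RatFunc ℚ) 1 := by
    simpa [qvar, RatFunc.algebraMap_X] using h
  have h2 := congrArg Polynomial.natDegree (RatFunc.algebraMap_injective ℚ h1)
  simp at h2
  omega

variable {d : Fin n → ℕ} {i : Fin n}

lemma qi_ne_zero : qi d i ≠ 0 := pow_ne_zero _ qvar_ne_zero

lemma qi_pow_sub_ne_zero (hd : 0 < d i) {m : ℕ} (hm : 0 < m) :
    qi d i ^ (m : ℤ) - qi d i ^ (-(m : ℤ)) ≠ 0 := by
  intro h
  have hq : qi d i ^ m ≠ 0 := pow_ne_zero _ qi_ne_zero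
  rw [zpow_neg, zpow_natCast, sub_eq_zero, ← mul_eq_one_iff_eq_inv₀ hq, qi, ← pow_mul,
    ← pow_add] at h
  exact qvar_pow_ne_one (by positivity) h

lemma qi_sub_inv_ne_zero (hd : 0 < d i) : qi d i - (qi d i)⁻¹ ≠ 0 := by
  simpa using qi_pow_sub_ne_zero hd one_pos

lemma qint_ne_zero (hd : 0 < d i) {m : ℕ} (hm : 0 < m) : qint d i m ≠ 0 :=
  div_ne_zero (qi_pow_sub_ne_zero hd hm) (qi_sub_inv_ne_zero hd)

lemma qfact_ne_zero (hd : 0 < d i) (m : ℕ) : qfact d i m ≠ 0 := by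
  induction m with
  | zero => exact one_ne_zero
  | succ m ih => exact mul_ne_zero ih (by exact_mod_cast qint_ne_zero hd m.succ_pos)

lemma qbinom_zero_right (hd : 0 < d i) (N : ℕ) : qbinom d i N 0 = 1 := by
  simp [qbinom, qfact, qfact_ne_zero hd N]

lemma qbinom_self (hd : 0 < d i) (N : ℕ) : qbinom d i N N = 1 := by
  simp [qbinom, qfact, qfact_ne_zero hd N]

lemma qbinom_symm {N s : ℕ} (hs : s ≤ N) : qbinom d i N (N - s) = qbinom d i N s := by
  rw [qbinom, qbinom, Nat.sub_sub_self hs, mul_comm (qfact d i s)]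

lemma qint_add {p : Kq} (hp : p = qi d i ∨ p = (qi d i)⁻¹) (k m : ℕ) :
    qint d i (k + m : ℤ) = (p ^ k)⁻¹ * qint d i m + p ^ m * qint d i k := by
  have hq : qi d i ≠ 0 := qi_ne_zero
  unfold qint
  rw [mul_div_assoc', mul_div_assoc', ← add_div]
  congr 1
  rcases hp with rfl | rfl <;>
  · simp only [neg_add, zpow_neg, zpow_add₀ hq, zpow_natCast, inv_pow, inv_inv]
    field_simp
    ring

lemma qbinom_pascal (hd : 0 < d i) {p : Kq} (hp : p = qi d i ∨ p = (qi d i)⁻¹) {N s : ℕ}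
    (hs : s < N) :
    qbinom d i (N + 1) (s + 1)
      = (p ^ (s + 1))⁻¹ * qbinom d i N (s + 1) + p ^ (N - s) * qbinom d i N s := by
  obtain ⟨m, rfl⟩ : ∃ m, N = s + 1 + m := ⟨N - (s + 1), by omega⟩
  have e1 : s + 1 + m + 1 - (s + 1) = m + 1 := by omega
  have e2 : s + 1 + m - (s + 1) = m := by omega
  have e3 : s + 1 + m - s = m + 1 := by omega
  have h := qint_add hp (s + 1) (m + 1)
  have hN : qfact d i (s + 1 + m + 1)
      = qfact d i (s + 1 + m) * qint d i ((s + 1 : ℕ) + (m + 1 : ℕ) : ℤ) := by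
    rw [qfact]; push_cast; ring_nf
  have hs' : qfact d i (s + 1) = qfact d i s * qint d i (s + 1 : ℕ) := by
    rw [qfact]; push_cast; rfl
  have hm' : qfact d i (m + 1) = qfact d i m * qint d i (m + 1 : ℕ) := by
    rw [qfact]; push_cast; rfl
  have n1 := qfact_ne_zero hd s
  have n2 := qfact_ne_zero hd m
  have n3 := qint_ne_zero hd s.succ_pos
  have n4 := qint_ne_zero hd m.succ_pos
  rw [Nat.succ_eq_add_one] at n3 n4
  simp only [qbinom, e1, e2, e3, hN, hs', hm', h]
  have hp0 : p ≠ 0 := by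
    rcases hp with rfl | rfl
    · exact qi_ne_zero
    · exact inv_ne_zero qi_ne_zero
  field_simp

end QuantumIntegers

section SerrePoly

variable {B : Type*} [Ring B] [Algebra Kq B] {d : Fin n → ℕ} {i : Fin n}

lemma map_serrePoly {C : Type*} [Ring C] [Algebra Kq C] (φ : B →ₐ[Kq] C) (N : ℕ) (x z : B) :
    φ (serrePoly d i N x z) = serrePoly d i N (φ x) (φ z) := by
  simp [serrePoly]

lemma serrePoly_add (N : ℕ) (x z w : B) :
    serrePoly d i N x (z + w) = serrePoly d i N x z + serrePoly d i N x w := by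
  simp [serrePoly, mul_add, add_mul, Finset.sum_add_distrib]

/-- The `q`-binomial theorem for iterated `q`-commutators. -/
lemma qcommSeq_eq_sum (hd : 0 < d i) {p : Kq} (hp : p = qi d i ∨ p = (qi d i)⁻¹) (t : Kq)
    (x z : B) (N : ℕ) :
    qcommSeq p t x z N = ∑ s ∈ Finset.range (N + 1),
      ((-1 : Kq) ^ s * qbinom d i N s * (t ^ s * p ^ (N * s) * (p ^ s)⁻¹)) •
        (x ^ (N - s) * z * x ^ s) := by
  have hp0 : p ≠ 0 := by
    rcases hp with rfl | rfl
    · exact qi_ne_zero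
    · exact inv_ne_zero qi_ne_zero
  induction N with
  | zero => simp [qcommSeq, qbinom_zero_right hd]
  | succ N ih =>
    rw [qcommSeq, ih, Finset.mul_sum, Finset.sum_mul, Finset.smul_sum,
      Finset.sum_range_succ' (fun s => x * _), Finset.sum_range_succ (fun s => (_ : Kq) • (_ * x)),
      Finset.sum_range_succ, Finset.sum_range_succ']
    have hmid : ∀ s ∈ Finset.range N,
        ((-1 : Kq) ^ (s + 1) * qbinom d i (N + 1) (s + 1) *
          (t ^ (s + 1) * p ^ ((N + 1) * (s + 1)) * (p ^ (s + 1))⁻¹)) •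
            (x ^ (N + 1 - (s + 1)) * z * x ^ (s + 1))
        = x * (((-1 : Kq) ^ (s + 1) * qbinom d i N (s + 1) *
            (t ^ (s + 1) * p ^ (N * (s + 1)) * (p ^ (s + 1))⁻¹)) •
              (x ^ (N - (s + 1)) * z * x ^ (s + 1)))
          - (t * p ^ (2 * N)) • (((-1 : Kq) ^ s * qbinom d i N s *
            (t ^ s * p ^ (N * s) * (p ^ s)⁻¹)) • (x ^ (N - s) * z * x ^ s) * x) := by
      intro s hs
      have hs := Finset.mem_range.1 hs
      have hx : x * (x ^ (N - (s + 1)) * z * x ^ (s + 1)) = x ^ (N - s) * z * x ^ (s + 1) := by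
        rw [show N - s = N - (s + 1) + 1 by omega, pow_succ' x (N - (s + 1))]
        simp only [mul_assoc]
      rw [mul_smul_comm, hx, smul_mul_assoc, mul_assoc _ (x ^ s) x, ← pow_succ, smul_smul,
        ← sub_smul, qbinom_pascal hd hp hs, Nat.add_sub_add_right]
      congr 1
      obtain ⟨m, rfl⟩ : ∃ m, N = s + m := ⟨N - s, by omega⟩
      rw [Nat.add_sub_cancel_left]
      field_simp
      ring
    rw [Finset.sum_congr rfl hmid, Finset.sum_sub_distrib]
    have hlast : ((-1 : Kq) ^ (N + 1) * qbinom d i (N + 1) (N + 1) *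
          (t ^ (N + 1) * p ^ ((N + 1) * (N + 1)) * (p ^ (N + 1))⁻¹)) •
            (x ^ (N + 1 - (N + 1)) * z * x ^ (N + 1))
        = -((t * p ^ (2 * N)) • (((-1 : Kq) ^ N * qbinom d i N N *
            (t ^ N * p ^ (N * N) * (p ^ N)⁻¹)) • (x ^ (N - N) * z * x ^ N) * x)) := by
      rw [smul_mul_assoc, mul_assoc _ (x ^ N) x, ← pow_succ, smul_smul, ← neg_smul,
        qbinom_self hd, qbinom_self hd, Nat.sub_self, Nat.sub_self]
      congr 1
      field_simp
      ring
    have hfirst : x * (((-1 : Kq) ^ 0 * qbinom d i N 0 *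
            (t ^ 0 * p ^ (N * 0) * (p ^ 0)⁻¹)) • (x ^ (N - 0) * z * x ^ 0))
        = ((-1 : Kq) ^ 0 * qbinom d i (N + 1) 0 *
          (t ^ 0 * p ^ ((N + 1) * 0) * (p ^ 0)⁻¹)) • (x ^ (N + 1 - 0) * z * x ^ 0) := by
      simp [qbinom_zero_right hd, pow_succ', mul_assoc]
    rw [hlast, hfirst]
    abel

lemma serrePoly_eq_qcommSeq (hd : 0 < d i) {p : Kq} (hp : p = qi d i ∨ p = (qi d i)⁻¹)
    {t : Kq} {N : ℕ} (ht : t * p ^ N = p) (x z : B) :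
    serrePoly d i N x z = qcommSeq p t x z N := by
  have hp0 : p ≠ 0 := by
    rcases hp with rfl | rfl
    · exact qi_ne_zero
    · exact inv_ne_zero qi_ne_zero
  rw [qcommSeq_eq_sum hd hp, serrePoly]
  refine Finset.sum_congr rfl fun s _ => ?_
  rw [pow_mul, ← mul_pow, ht, mul_inv_cancel₀ (pow_ne_zero _ hp0), mul_one]

lemma qcommSeq_add_left {p t : Kq} {x y z : B} (hxz : x * z = t • (z * x))
    (hxy : x * y = p ^ 2 • (y * x)) (k : ℕ) :
    qcommSeq p t (x + y) z k = qcommSeq p t y z k ∧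
      x * qcommSeq p t y z k = (t * p ^ (2 * k)) • (qcommSeq p t y z k * x) := by
  induction k with
  | zero => simpa [qcommSeq] using hxz
  | succ k ih =>
    obtain ⟨h1, h2⟩ := ih
    refine ⟨?_, ?_⟩
    · simp only [qcommSeq, h1, add_mul, mul_add, smul_add, h2]
      abel
    · have h3 : x * (y * qcommSeq p t y z k)
          = (t * p ^ (2 * (k + 1))) • (y * qcommSeq p t y z k * x) := by
        rw [← mul_assoc, hxy, smul_mul_assoc, mul_assoc, h2, mul_smul_comm, smul_smul, mul_assoc]
        congr 1
        ring
      have h4 : x * (qcommSeq p t y z k * y)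
          = (t * p ^ (2 * (k + 1))) • (qcommSeq p t y z k * y * x) := by
        rw [← mul_assoc, h2, smul_mul_assoc, mul_assoc, hxy, mul_smul_comm, smul_smul, ← mul_assoc]
        congr 1
        ring
      simp only [qcommSeq, mul_sub, sub_mul, mul_smul_comm, smul_mul_assoc, h3, h4, smul_sub]
      rw [smul_comm]

/-- Additivity of the quantum Serre expression on suitably `q`-commuting summands. -/
lemma serrePoly_add_add (hd : 0 < d i) {c : ℤ} (hc : c ≤ 0) {x y z w : B}
    (hxy : y * x = qi d i ^ 2 • (x * y)) (hxw : w * x = qi d i ^ c • (x * w))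
    (hzy : y * z = qi d i ^ c • (z * y)) :
    serrePoly d i (1 - c).toNat (x + y) (z + w)
      = serrePoly d i (1 - c).toNat x z + serrePoly d i (1 - c).toNat y w := by
  have hq : qi d i ≠ 0 := qi_ne_zero
  have hN : ((1 - c).toNat : ℤ) = 1 - c := Int.toNat_of_nonneg (by omega)
  have ht : qi d i ^ c * qi d i ^ (1 - c).toNat = qi d i := by
    rw [← zpow_natCast, hN, ← zpow_add₀ hq]
    simp
  have ht' : (qi d i ^ c)⁻¹ * (qi d i)⁻¹ ^ (1 - c).toNat = (qi d i)⁻¹ := by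
    rw [inv_pow, ← mul_inv, ht]
  have hxy' : x * y = (qi d i)⁻¹ ^ 2 • (y * x) := by
    rw [hxy, smul_smul, ← mul_pow, inv_mul_cancel₀ hq, one_pow, one_smul]
  have hxw' : x * w = (qi d i ^ c)⁻¹ • (w * x) := by
    rw [hxw, smul_smul, inv_mul_cancel₀ (zpow_ne_zero _ hq), one_smul]
  rw [serrePoly_add]
  congr 1
  · rw [serrePoly_eq_qcommSeq hd (.inl rfl) ht, serrePoly_eq_qcommSeq hd (.inl rfl) ht, add_comm,
      (qcommSeq_add_left hzy hxy _).1]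
  · rw [serrePoly_eq_qcommSeq hd (.inr rfl) ht', serrePoly_eq_qcommSeq hd (.inr rfl) ht',
      (qcommSeq_add_left hxw' hxy' _).1]

lemma pow_mul_of_qcomm {μ : Kq} {k x : B} (h : k * x = μ • (x * k)) (m : ℕ) :
    k ^ m * x = μ ^ m • (x * k ^ m) := by
  induction m with
  | zero => simp
  | succ m ih =>
    rw [pow_succ, mul_assoc, h, mul_smul_comm, ← mul_assoc, ih, smul_mul_assoc, smul_smul,
      pow_succ, mul_assoc, mul_comm μ]

lemma mul_pow_of_qcomm {μ : Kq} {k x : B} (h : k * x = μ • (x * k)) (m : ℕ) :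
    k * x ^ m = μ ^ m • (x ^ m * k) := by
  induction m with
  | zero => simp
  | succ m ih =>
    rw [pow_succ, ← mul_assoc, ih, smul_mul_assoc, mul_assoc, h, mul_smul_comm, smul_smul,
      pow_succ, mul_assoc]

/-- Moving `q`-commuting factors out of a word `x ^ m * z * x ^ s`. -/
lemma twisted_word {μ ν : Kq} {x z k l : B} (hkx : k * x = μ • (x * k))
    (hkz : k * z = ν • (z * k)) (hlx : l * x = ν • (x * l)) (hkl : k * l = l * k) (m s : ℕ) :
    (x * k) ^ m * (z * l) * (x * k) ^ s
      = (∏ j ∈ Finset.range (m + s), (μ ^ j * ν)) • (x ^ m * z * x ^ s * (k ^ (m + s) * l)) := by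
  induction s with
  | zero =>
    induction m with
    | zero => simp
    | succ m ih =>
      simp only [pow_zero, mul_one, add_zero] at ih ⊢
      rw [pow_succ', mul_assoc, ih, mul_smul_comm, Finset.prod_range_succ, ← smul_smul]
      congr 1
      calc x * k * (x ^ m * z * (k ^ m * l)) = x * (k * x ^ m) * z * (k ^ m * l) := by
            simp only [mul_assoc]
        _ = μ ^ m • (x * x ^ m * (k * z) * (k ^ m * l)) := by
            rw [mul_pow_of_qcomm hkx]
            simp only [mul_assoc, mul_smul_comm, smul_mul_assoc]
        _ = (μ ^ m * ν) • (x ^ (m + 1) * z * (k ^ (m + 1) * l)) := by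
            rw [hkz, pow_succ' x, pow_succ' k, ← smul_smul]
            simp only [mul_assoc, mul_smul_comm, smul_mul_assoc]
  | succ s ih =>
    rw [pow_succ (x * k) s, ← mul_assoc, ih, smul_mul_assoc, ← add_assoc, Finset.prod_range_succ,
      ← smul_smul]
    congr 1
    calc x ^ m * z * x ^ s * (k ^ (m + s) * l) * (x * k)
        = x ^ m * z * x ^ s * (k ^ (m + s) * (l * x) * k) := by simp only [mul_assoc]
      _ = ν • (x ^ m * z * x ^ s * (k ^ (m + s) * x * (l * k))) := by
          rw [hlx]; simp only [mul_assoc, mul_smul_comm, smul_mul_assoc]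
      _ = _ := by
          rw [pow_mul_of_qcomm hkx, ← hkl, pow_succ x, pow_succ k, mul_comm (μ ^ _), ← smul_smul]
          simp only [mul_assoc, mul_smul_comm, smul_mul_assoc]

lemma serrePoly_twist {μ ν : Kq} {x z k l : B} (hkx : k * x = μ • (x * k))
    (hkz : k * z = ν • (z * k)) (hlx : l * x = ν • (x * l)) (hkl : k * l = l * k) {N : ℕ}
    (h : serrePoly d i N x z = 0) : serrePoly d i N (x * k) (z * l) = 0 := by
  have : serrePoly d i N (x * k) (z * l)
      = (∏ j ∈ Finset.range N, (μ ^ j * ν)) • (serrePoly d i N x z * (k ^ N * l)) := by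
    rw [serrePoly, serrePoly, Finset.sum_mul, Finset.smul_sum]
    refine Finset.sum_congr rfl fun s hs => ?_
    rw [twisted_word hkx hkz hlx hkl,
      Nat.sub_add_cancel (Nat.lt_succ_iff.1 (Finset.mem_range.1 hs)), smul_mul_assoc, smul_comm]
  rw [this, h, zero_mul, smul_zero]

lemma serrePoly_op (N : ℕ) (x z : B) :
    serrePoly d i N (MulOpposite.op x) (MulOpposite.op z)
      = MulOpposite.op ((-1 : Kq) ^ N • serrePoly d i N x z) := by
  apply MulOpposite.unop_injective
  rw [MulOpposite.unop_op, serrePoly, serrePoly, Finset.unop_sum, Finset.smul_sum,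
    ← Finset.sum_range_reflect]
  refine Finset.sum_congr rfl fun s hs => ?_
  have hs : s ≤ N := Nat.lt_succ_iff.1 (Finset.mem_range.1 hs)
  have e : N + 1 - 1 - s = N - s := by omega
  have hsign : (-1 : Kq) ^ (N - s) = (-1) ^ N * (-1) ^ s := by
    rw [← pow_add, show N + s = N - s + 2 * s by omega, pow_add _ _ (2 * s), pow_mul]
    simp
  rw [e, Nat.sub_sub_self hs, qbinom_symm hs, hsign, smul_smul]
  simp [mul_assoc]

end SerrePoly

/-- A family of elements of an algebra satisfying the defining relations of `U_q`. -/
structure QFamily {B : Type*} [Ring B] [Algebra Kq B] (a : Fin n → Fin n → ℤ)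
    (d r : Fin n → ℕ) (f : Gen n → B) : Prop where
  KKinv (i : Fin n) : f (.K i) * f (.Kinv i) = 1
  KinvK (i : Fin n) : f (.Kinv i) * f (.K i) = 1
  gginv : f .g * f .ginv = 1
  ginvg : f .ginv * f .g = 1
  gcomm (x : Gen n) : f .g * f x = f x * f .g
  gsq : f .g * f .g = ((List.finRange n).map fun i => f (.K i) ^ r i).prod
  KK (i j : Fin n) : f (.K i) * f (.K j) = f (.K j) * f (.K i)
  KE (i j : Fin n) : f (.K i) * f (.E j) = (qi d i ^ a i j) • (f (.E j) * f (.K i))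
  KF (i j : Fin n) : f (.K i) * f (.F j) = (qi d i ^ (-a i j)) • (f (.F j) * f (.K i))
  EF (i j : Fin n) : f (.E i) * f (.F j) - f (.F j) * f (.E i)
    = if i = j then ((qi d i - (qi d i)⁻¹)⁻¹) • (f (.K i) - f (.Kinv i)) else 0
  serreE (i j : Fin n) (h : i ≠ j) :
    serrePoly d i (1 - a i j).toNat (f (.E i)) (f (.E j)) = 0
  serreF (i j : Fin n) (h : i ≠ j) :
    serrePoly d i (1 - a i j).toNat (f (.F i)) (f (.F j)) = 0

section UniversalProperty

variable {B : Type*} [Ring B] [Algebra Kq B] {a : Fin n → Fin n → ℤ} {d r : Fin n → ℕ}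
  {f : Gen n → B}

lemma lift_ι_apply (f : Gen n → B) (x : Gen n) : FreeAlgebra.lift Kq f (ι x) = f x :=
  FreeAlgebra.lift_ι_apply f x

lemma QFamily.lift_eq (hf : QFamily a d r f) ⦃x y : FA n⦄ (h : QRel a d r x y) :
    FreeAlgebra.lift Kq f x = FreeAlgebra.lift Kq f y := by
  cases h with
  | KKinv i => simpa [lift_ι_apply] using hf.KKinv i
  | KinvK i => simpa [lift_ι_apply] using hf.KinvK i
  | gginv => simpa [lift_ι_apply] using hf.gginv
  | ginvg => simpa [lift_ι_apply] using hf.ginvg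
  | gcomm x => simpa [lift_ι_apply] using hf.gcomm x
  | gsq => simpa [lift_ι_apply, map_list_prod, Function.comp_def] using hf.gsq
  | KK i j => simpa [lift_ι_apply] using hf.KK i j
  | KE i j => simpa [lift_ι_apply] using hf.KE i j
  | KF i j => simpa [lift_ι_apply] using hf.KF i j
  | EF i j =>
    have := hf.EF i j
    split_ifs at this ⊢ <;> simpa [lift_ι_apply] using this
  | serreEE i j h => simpa [_root_.serreE, serrePoly, lift_ι_apply] using hf.serreE i j h
  | serreFF i j h => simpa [_root_.serreF, serrePoly, lift_ι_apply] using hf.serreF i j h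

/-- The algebra homomorphism out of `U_q` determined by a family satisfying the relations. -/
def QFamily.lift (hf : QFamily a d r f) : Uq a d r →ₐ[Kq] B :=
  RingQuot.liftAlgHom Kq ⟨FreeAlgebra.lift Kq f, hf.lift_eq⟩

lemma QFamily.lift_gen (hf : QFamily a d r f) (x : Gen n) : hf.lift (gen a d r x) = f x := by
  rw [QFamily.lift, gen, RingQuot.liftAlgHom_mkAlgHom_apply, lift_ι_apply]

lemma qFamily_gen (a : Fin n → Fin n → ℤ) (d r : Fin n → ℕ) :
    QFamily a d r (gen a d r) := by
  have key : ∀ {x y}, QRel a d r x y →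
      RingQuot.mkAlgHom Kq (QRel a d r) x = RingQuot.mkAlgHom Kq (QRel a d r) y :=
    fun h => RingQuot.mkAlgHom_rel Kq h
  constructor
  · intro i; simpa [gen] using key (.KKinv i)
  · intro i; simpa [gen] using key (.KinvK i)
  · simpa [gen] using key .gginv
  · simpa [gen] using key .ginvg
  · intro x; simpa [gen] using key (.gcomm x)
  · simpa [gen, map_list_prod, Function.comp_def] using key .gsq
  · intro i j; simpa [gen] using key (.KK i j)
  · intro i j; simpa [gen] using key (.KE i j)
  · intro i j; simpa [gen] using key (.KF i j)
  · intro i j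
    have := key (.EF i j)
    split_ifs at this ⊢ <;> simpa [gen] using this
  · intro i j h; simpa [gen, _root_.serreE, serrePoly] using key (.serreEE i j h)
  · intro i j h; simpa [gen, _root_.serreF, serrePoly] using key (.serreFF i j h)

lemma Uq.algHom_ext {C : Type*} [Semiring C] [Algebra Kq C] {φ ψ : Uq a d r →ₐ[Kq] C}
    (h : ∀ x, φ (gen a d r x) = ψ (gen a d r x)) : φ = ψ :=
  RingQuot.ringQuot_ext' _ _ _ (FreeAlgebra.hom_ext (funext h))

/-- Homomorphisms out of `U_q` need only be compared on `E_i`, `F_i`, `K_i` and `γ^{1/2}`. -/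
lemma Uq.algHom_ext' {C : Type*} [Semiring C] [Algebra Kq C] {φ ψ : Uq a d r →ₐ[Kq] C}
    (hE : ∀ i, φ (gen a d r (.E i)) = ψ (gen a d r (.E i)))
    (hF : ∀ i, φ (gen a d r (.F i)) = ψ (gen a d r (.F i)))
    (hK : ∀ i, φ (gen a d r (.K i)) = ψ (gen a d r (.K i)))
    (hg : φ (gen a d r .g) = ψ (gen a d r .g)) : φ = ψ := by
  have inv : ∀ {x y : Uq a d r}, x * y = 1 → y * x = 1 → φ x = ψ x → φ y = ψ y := by
    intro x y hxy hyx h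
    refine left_inv_eq_right_inv (a := φ x) ?_ ?_
    · rw [← map_mul, hyx, map_one]
    · rw [h, ← map_mul, hxy, map_one]
  have H := qFamily_gen a d r
  refine Uq.algHom_ext fun x => ?_
  cases x with
  | E i => exact hE i
  | F i => exact hF i
  | K i => exact hK i
  | Kinv i => exact inv (H.KKinv i) (H.KinvK i) (hK i)
  | g => exact hg
  | ginv => exact inv H.gginv H.ginvg hg

lemma Uq.induction {P : Uq a d r → Prop} (hgen : ∀ x, P (gen a d r x))
    (halg : ∀ c : Kq, P (algebraMap Kq _ c)) (hadd : ∀ x y, P x → P y → P (x + y))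
    (hmul : ∀ x y, P x → P y → P (x * y)) (u : Uq a d r) : P u := by
  obtain ⟨w, rfl⟩ := RingQuot.mkAlgHom_surjective Kq (QRel a d r) u
  induction w using FreeAlgebra.induction with
  | grade0 c => simpa using halg c
  | grade1 x => exact hgen x
  | mul x y hx hy => simpa using hmul _ _ hx hy
  | add x y hx hy => simpa using hadd _ _ hx hy

end UniversalProperty

section Antipode

variable {R B : Type*} [CommRing R] [Ring B] [Algebra R B]

lemma mul'_rTensor_mul {S : B →ₗ[R] B} (hS : ∀ x y, S (x * y) = S y * S x)
    {u : B ⊗[R] B} {e : R}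
    (hu : LinearMap.mul' R B (S.rTensor B u) = algebraMap R B e) (v : B ⊗[R] B) :
    LinearMap.mul' R B (S.rTensor B (u * v))
      = e • LinearMap.mul' R B (S.rTensor B v) := by
  induction v using TensorProduct.induction_on with
  | zero => simp
  | add v w hv hw => simp only [mul_add, map_add, hv, hw, smul_add]
  | tmul b c =>
    have h : ∀ u : B ⊗[R] B, LinearMap.mul' R B (S.rTensor B (u * b ⊗ₜ[R] c))
        = S b * LinearMap.mul' R B (S.rTensor B u) * c := by
      intro u
      induction u using TensorProduct.induction_on with
      | zero => simp
      | add v w hv hw => simp only [mul_add, add_mul, map_add, hv, hw]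
      | tmul x y => simp [hS, mul_assoc]
    rw [h, hu, ← Algebra.commutes, mul_assoc, ← Algebra.smul_def]
    simp

lemma mul'_lTensor_mul {S : B →ₗ[R] B} (hS : ∀ x y, S (x * y) = S y * S x)
    {v : B ⊗[R] B} {e : R}
    (hv : LinearMap.mul' R B (S.lTensor B v) = algebraMap R B e) (u : B ⊗[R] B) :
    LinearMap.mul' R B (S.lTensor B (u * v))
      = e • LinearMap.mul' R B (S.lTensor B u) := by
  induction u using TensorProduct.induction_on with
  | zero => simp
  | add v w hv hw => simp only [add_mul, map_add, hv, hw, smul_add]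
  | tmul b c =>
    have h : ∀ v : B ⊗[R] B, LinearMap.mul' R B (S.lTensor B (b ⊗ₜ[R] c * v))
        = b * LinearMap.mul' R B (S.lTensor B v) * S c := by
      intro u
      induction u using TensorProduct.induction_on with
      | zero => simp
      | add v w hv hw => simp only [mul_add, add_mul, map_add, hv, hw]
      | tmul x y => simp [hS, mul_assoc]
    rw [h, hv, ← Algebra.commutes, mul_assoc, ← Algebra.smul_def]
    simp

/-- A left antipode and a right antipode of the same coalgebra structure coincide. -/
lemma antipode_unique {Δ : B →ₗ[R] B ⊗[R] B} {ε : B →ₗ[R] R} {S T : B →ₗ[R] B}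
    (hΔ : ∀ x, TensorProduct.assoc R B B B (Δ.rTensor B (Δ x)) = Δ.lTensor B (Δ x))
    (hl : ∀ x, TensorProduct.lid R B (ε.rTensor B (Δ x)) = x)
    (hr : ∀ x, TensorProduct.rid R B (ε.lTensor B (Δ x)) = x)
    (hS : ∀ x, LinearMap.mul' R B (S.rTensor B (Δ x)) = algebraMap R B (ε x))
    (hT : ∀ x, LinearMap.mul' R B (T.lTensor B (Δ x)) = algebraMap R B (ε x)) : S = T := by
  let m : B ⊗[R] (B ⊗[R] B) →ₗ[R] B :=
    LinearMap.mul' R B ∘ₗ TensorProduct.map S (LinearMap.mul' R B ∘ₗ T.lTensor B)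
  have h1 : ∀ t, m (TensorProduct.assoc R B B B (Δ.rTensor B t))
      = T (TensorProduct.lid R B (ε.rTensor B t)) := by
    intro t
    induction t using TensorProduct.induction_on with
    | zero => simp
    | add v w hv hw => simp only [map_add, hv, hw]
    | tmul x y =>
      have : ∀ u : B ⊗[R] B, m (TensorProduct.assoc R B B B (u ⊗ₜ[R] y))
          = LinearMap.mul' R B (S.rTensor B u) * T y := by
        intro u
        induction u using TensorProduct.induction_on with
        | zero => simp
        | add v w hv hw => simp only [TensorProduct.add_tmul, add_mul, map_add, hv, hw]
        | tmul x y => simp [m, mul_assoc]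
      simp [this, hS, ← Algebra.smul_def]
  have h2 : ∀ t, m (Δ.lTensor B t) = S (TensorProduct.rid R B (ε.lTensor B t)) := by
    intro t
    induction t using TensorProduct.induction_on with
    | zero => simp
    | add v w hv hw => simp only [map_add, hv, hw]
    | tmul x y => simp [m, hT, ← Algebra.commutes (ε y), ← Algebra.smul_def]
  ext x
  have := h1 (Δ x)
  rw [hΔ, h2, hl, hr] at this
  exact this

end Antipode

/-- The values of the comultiplication on the generators. -/
def comulGen {B : Type*} [Ring B] [Algebra Kq B] (f : Gen n → B) : Gen n → B ⊗[Kq] B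
  | .E i => f (.E i) ⊗ₜ f (.Kinv i) + 1 ⊗ₜ f (.E i)
  | .F i => f (.F i) ⊗ₜ 1 + f (.K i) ⊗ₜ f (.F i)
  | .K i => f (.K i) ⊗ₜ f (.K i)
  | .Kinv i => f (.Kinv i) ⊗ₜ f (.Kinv i)
  | .g => f .g ⊗ₜ f .g
  | .ginv => f .ginv ⊗ₜ f .ginv

/-- The values of the counit on the generators. -/
def counitGen : Gen n → Kq
  | .E _ => 0
  | .F _ => 0
  | .K _ => 1
  | .Kinv _ => 1
  | .g => 1
  | .ginv => 1

/-- The values of the antipode on the generators. -/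
def antipodeGen {B : Type*} [Ring B] [Algebra Kq B] (f : Gen n → B) : Gen n → B
  | .E i => -(f (.E i) * f (.K i))
  | .F i => -(f (.Kinv i) * f (.F i))
  | .K i => f (.Kinv i)
  | .Kinv i => f (.K i)
  | .g => f .ginv
  | .ginv => f .g

namespace QFamily

variable {B : Type*} [Ring B] [Algebra Kq B] {a : Fin n → Fin n → ℤ} {d r : Fin n → ℕ}
  {f : Gen n → B}

lemma qcomm_inv {k k' x : B} {c : Kq} (hc : c ≠ 0) (h₁ : k * k' = 1) (h₂ : k' * k = 1)
    (h : k * x = c • (x * k)) : k' * x = c⁻¹ • (x * k') := by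
  calc k' * x = c⁻¹ • (k' * (c • (x * k)) * k') := by
        rw [mul_smul_comm, smul_mul_assoc, smul_smul, inv_mul_cancel₀ hc, one_smul]
        simp only [mul_assoc, h₁, mul_one]
    _ = c⁻¹ • (x * k') := by rw [← h, ← mul_assoc, h₂, one_mul]

lemma comm_inv {k k' x : B} (h₁ : k * k' = 1) (h₂ : k' * k = 1) (h : k * x = x * k) :
    k' * x = x * k' := by
  simpa using qcomm_inv (c := 1) one_ne_zero h₁ h₂ (by simpa using h)

lemma KinvE (hf : QFamily a d r f) (i j : Fin n) :
    f (.Kinv i) * f (.E j) = (qi d i ^ (-a i j)) • (f (.E j) * f (.Kinv i)) := by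
  rw [zpow_neg]
  exact qcomm_inv (zpow_ne_zero _ qi_ne_zero) (hf.KKinv i) (hf.KinvK i) (hf.KE i j)

lemma KinvF (hf : QFamily a d r f) (i j : Fin n) :
    f (.Kinv i) * f (.F j) = (qi d i ^ a i j) • (f (.F j) * f (.Kinv i)) := by
  have h := qcomm_inv (zpow_ne_zero _ qi_ne_zero) (hf.KKinv i) (hf.KinvK i) (hf.KF i j)
  rwa [zpow_neg, inv_inv] at h

lemma KinvK_comm (hf : QFamily a d r f) (i j : Fin n) :
    f (.Kinv i) * f (.K j) = f (.K j) * f (.Kinv i) :=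
  comm_inv (hf.KKinv i) (hf.KinvK i) (hf.KK i j)

lemma KinvKinv (hf : QFamily a d r f) (i j : Fin n) :
    f (.Kinv i) * f (.Kinv j) = f (.Kinv j) * f (.Kinv i) :=
  (comm_inv (hf.KKinv j) (hf.KinvK j) (hf.KinvK_comm i j).symm).symm

lemma ginv_comm (hf : QFamily a d r f) (x : Gen n) : f .ginv * f x = f x * f .ginv :=
  comm_inv hf.gginv hf.ginvg (hf.gcomm x)

lemma counit (a : Fin n → Fin n → ℤ) (d r : Fin n → ℕ) :
    QFamily a d r (counitGen (n := n)) where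
  KKinv _ := by simp [counitGen]
  KinvK _ := by simp [counitGen]
  gginv := by simp [counitGen]
  ginvg := by simp [counitGen]
  gcomm _ := mul_comm _ _
  gsq := by simp [counitGen]
  KK _ _ := mul_comm _ _
  KE _ _ := by simp [counitGen]
  KF _ _ := by simp [counitGen]
  EF _ _ := by simp [counitGen]
  serreE _ _ _ := by simp [counitGen, serrePoly]
  serreF _ _ _ := by simp [counitGen, serrePoly]

end QFamily

lemma CartanData.qi_zpow_symm {a : Fin n → Fin n → ℤ} {d r : Fin n → ℕ}
    (hC : CartanData n a d r) (i j : Fin n) : qi d j ^ a j i = qi d i ^ a i j := by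
  rw [qi, qi, ← zpow_natCast, ← zpow_natCast, ← zpow_mul, ← zpow_mul, hC.symmetrizable i j]

namespace QFamily

variable {B : Type*} [Ring B] [Algebra Kq B] {a : Fin n → Fin n → ℤ} {d r : Fin n → ℕ}
  {f : Gen n → B}

lemma qi_zpow_self (hC : CartanData n a d r) (i : Fin n) : qi d i ^ a i i = qi d i ^ 2 := by
  rw [hC.diag]
  exact zpow_natCast _ 2

lemma serrePoly_tmul_eq_zero {i : Fin n} {N : ℕ} {x z k l : B}
    (hkl : k * l = l * k) (h : serrePoly d i N x z = 0) :
    serrePoly d i N (x ⊗ₜ[Kq] k) (z ⊗ₜ[Kq] l) = 0 := by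
  have h' := map_serrePoly (d := d) (i := i)
    (Algebra.TensorProduct.includeLeft : B →ₐ[Kq] B ⊗[Kq] B) N x z
  rw [h, map_zero] at h'
  simpa using serrePoly_twist (μ := 1) (ν := 1) (k := (1 : B) ⊗ₜ[Kq] k) (l := (1 : B) ⊗ₜ[Kq] l)
    (by simp) (by simp) (by simp) (by simp [hkl]) h'.symm

lemma serrePoly_tmul_eq_zero' {i : Fin n} {N : ℕ} {x z k l : B}
    (hkl : k * l = l * k) (h : serrePoly d i N x z = 0) :
    serrePoly d i N (k ⊗ₜ[Kq] x) (l ⊗ₜ[Kq] z) = 0 := by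
  have h' := map_serrePoly (d := d) (i := i)
    (Algebra.TensorProduct.includeRight : B →ₐ[Kq] B ⊗[Kq] B) N x z
  rw [h, map_zero] at h'
  simpa using serrePoly_twist (μ := 1) (ν := 1) (k := k ⊗ₜ[Kq] (1 : B)) (l := l ⊗ₜ[Kq] (1 : B))
    (by simp) (by simp) (by simp) (by simp [hkl]) h'.symm

lemma comul (hC : CartanData n a d r) (hf : QFamily a d r f) :
    QFamily a d r (comulGen f) where
  KKinv i := by simp [comulGen, hf.KKinv, Algebra.TensorProduct.one_def]
  KinvK i := by simp [comulGen, hf.KinvK, Algebra.TensorProduct.one_def]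
  gginv := by simp [comulGen, hf.gginv, Algebra.TensorProduct.one_def]
  ginvg := by simp [comulGen, hf.ginvg, Algebra.TensorProduct.one_def]
  gcomm x := by
    have hg := hf.gcomm
    cases x <;> simp [comulGen, mul_add, add_mul, hg (.E _), hg (.F _), hg (.K _), hg (.Kinv _),
      hg .ginv]
  gsq := by
    have h : ∀ l : List (Fin n),
        (l.map fun i => (f (.K i) ⊗ₜ[Kq] f (.K i) : B ⊗[Kq] B) ^ r i).prod
        = (l.map fun i => f (.K i) ^ r i).prod ⊗ₜ[Kq] (l.map fun i => f (.K i) ^ r i).prod := by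
      intro l
      induction l with
      | nil => simp [Algebra.TensorProduct.one_def]
      | cons i l ih =>
        rw [List.map_cons, List.map_cons, List.prod_cons, List.prod_cons, ih,
          Algebra.TensorProduct.tmul_pow, Algebra.TensorProduct.tmul_mul_tmul]
    simp only [comulGen, h, Algebra.TensorProduct.tmul_mul_tmul, hf.gsq]
  KK i j := by simp [comulGen, hf.KK i j]
  KE i j := by
    simp [comulGen, mul_add, add_mul, hf.KE i j, (hf.KinvK_comm j i).symm,
      TensorProduct.smul_tmul']
  KF i j := by
    simp [comulGen, mul_add, add_mul, hf.KF i j, hf.KK i j, TensorProduct.smul_tmul']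
  EF i j := by
    have h₁ : (f (.E i) * f (.K j)) ⊗ₜ[Kq] (f (.Kinv i) * f (.F j))
        = (f (.K j) * f (.E i)) ⊗ₜ[Kq] (f (.F j) * f (.Kinv i)) := by
      rw [hf.KinvF, hf.KE, hC.qi_zpow_symm i j, TensorProduct.tmul_smul, TensorProduct.smul_tmul']
    have h₂ : comulGen f (.E i) * comulGen f (.F j) - comulGen f (.F j) * comulGen f (.E i)
        = (f (.E i) * f (.F j) - f (.F j) * f (.E i)) ⊗ₜ[Kq] f (.Kinv i)
          + f (.K j) ⊗ₜ[Kq] (f (.E i) * f (.F j) - f (.F j) * f (.E i)) := by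
      simp only [comulGen, mul_add, add_mul, Algebra.TensorProduct.tmul_mul_tmul, mul_one,
        one_mul, h₁, TensorProduct.sub_tmul, TensorProduct.tmul_sub]
      abel
    rw [h₂, hf.EF]
    split_ifs with hij
    · subst hij
      simp only [comulGen, TensorProduct.tmul_smul, ← TensorProduct.smul_tmul',
        TensorProduct.sub_tmul, TensorProduct.tmul_sub, ← smul_add]
      congr 1
      abel
    · simp
  serreE i j h := by
    have hq : qi d i ≠ 0 := qi_ne_zero
    have hc : qi d i ^ a i j * (qi d i ^ a i j)⁻¹ = 1 := mul_inv_cancel₀ (zpow_ne_zero _ hq)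
    rw [comulGen, comulGen, serrePoly_add_add (hC.d_pos i) (hC.offdiag i j h),
      serrePoly_tmul_eq_zero (hf.KinvKinv i j) (hf.serreE i j h),
      serrePoly_tmul_eq_zero' rfl (hf.serreE i j h), add_zero]
    · simp [hf.KinvE, qi_zpow_self hC, smul_smul, hq]
    · simp [hf.KinvE, smul_smul, hc]
    · simp [hf.KinvE, hC.qi_zpow_symm i j, smul_smul, hc]
  serreF i j h := by
    have hq : qi d i ≠ 0 := qi_ne_zero
    have hc : qi d i ^ a i j * (qi d i ^ a i j)⁻¹ = 1 := mul_inv_cancel₀ (zpow_ne_zero _ hq)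
    rw [comulGen, comulGen, add_comm (f (.F i) ⊗ₜ[Kq] 1), add_comm (f (.F j) ⊗ₜ[Kq] 1),
      serrePoly_add_add (hC.d_pos i) (hC.offdiag i j h),
      serrePoly_tmul_eq_zero rfl (hf.serreF i j h),
      serrePoly_tmul_eq_zero' (hf.KK i j) (hf.serreF i j h), add_zero]
    · simp [hf.KF, qi_zpow_self hC, smul_smul, hq, ← TensorProduct.smul_tmul']
    · simp [hf.KF, smul_smul, hc, ← TensorProduct.smul_tmul']
    · simp [hf.KF, hC.qi_zpow_symm i j, smul_smul, hc, ← TensorProduct.smul_tmul']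

lemma antipode (hC : CartanData n a d r) (hf : QFamily a d r f) :
    QFamily a d r (fun x => MulOpposite.op (antipodeGen f x)) where
  KKinv i := by simp [antipodeGen, ← MulOpposite.op_mul, hf.KKinv]
  KinvK i := by simp [antipodeGen, ← MulOpposite.op_mul, hf.KinvK]
  gginv := by simp [antipodeGen, ← MulOpposite.op_mul, hf.gginv]
  ginvg := by simp [antipodeGen, ← MulOpposite.op_mul, hf.ginvg]
  gcomm x := by
    have hg : ∀ x, Commute (f .ginv) (f x) := hf.ginv_comm
    rw [← MulOpposite.op_mul, ← MulOpposite.op_mul]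
    congr 1
    refine Commute.eq (Commute.symm ?_)
    cases x with
    | E i => exact ((hg _).mul_right (hg _)).neg_right
    | F i => exact ((hg _).mul_right (hg _)).neg_right
    | K i => exact hg _
    | Kinv i => exact hg _
    | g => exact hg _
    | ginv => exact hg _
  gsq := by
    have h : ∀ l : List (Fin n),
        (l.map fun i => MulOpposite.op (f (.Kinv i)) ^ r i).prod.unop
          * (l.map fun i => f (.K i) ^ r i).prod = 1 := by
      intro l
      induction l with
      | nil => simp
      | cons i l ih =>
        have hi : f (.Kinv i) ^ r i * f (.K i) ^ r i = 1 := by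
          rw [← (show Commute (f (.Kinv i)) (f (.K i)) from hf.KinvK_comm i i).mul_pow, hf.KinvK,
            one_pow]
        rw [List.map_cons, List.map_cons, List.prod_cons, List.prod_cons, MulOpposite.unop_mul,
          ← MulOpposite.op_pow, MulOpposite.unop_op, mul_assoc, ← mul_assoc (f (.Kinv i) ^ r i),
          hi, one_mul, ih]
    have h' : f .g * f .g * (f .ginv * f .ginv) = 1 := by
      rw [mul_assoc, ← mul_assoc (f .g) (f .ginv), hf.gginv, one_mul, hf.gginv]
    apply MulOpposite.unop_injective
    rw [hf.gsq] at h'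
    exact (left_inv_eq_right_inv (h _) h').symm
  KK i j := by simp [antipodeGen, ← MulOpposite.op_mul, hf.KinvKinv i j]
  KE i j := by
    rw [← MulOpposite.op_mul, ← MulOpposite.op_mul, ← MulOpposite.op_smul]
    congr 1
    simp only [antipodeGen, neg_mul, mul_neg, smul_neg, mul_assoc]
    rw [← mul_assoc (f (.Kinv i)), hf.KinvE, smul_mul_assoc, smul_smul, mul_assoc,
      hf.KinvK_comm i j, ← zpow_add₀ qi_ne_zero]
    simp
  KF i j := by
    rw [← MulOpposite.op_mul, ← MulOpposite.op_mul, ← MulOpposite.op_smul]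
    congr 1
    simp only [antipodeGen, neg_mul, mul_neg, smul_neg]
    rw [← mul_assoc, hf.KinvKinv i j, mul_assoc, mul_assoc, hf.KinvF, mul_smul_comm, smul_smul,
      ← zpow_add₀ qi_ne_zero]
    simp
  EF i j := by
    have h₁ : f (.E i) * f (.K i) * (f (.Kinv j) * f (.F j))
        = f (.Kinv j) * (f (.E i) * f (.F j)) * f (.K i) := by
      have hq : qi d i ^ a i j ≠ 0 := zpow_ne_zero _ qi_ne_zero
      calc f (.E i) * f (.K i) * (f (.Kinv j) * f (.F j))
          = f (.E i) * f (.Kinv j) * (f (.K i) * f (.F j)) := by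
            rw [mul_assoc, ← mul_assoc (f (.K i)), ← hf.KinvK_comm j i]
            simp only [mul_assoc]
        _ = (qi d i ^ (-a i j)) • (f (.E i) * f (.Kinv j)) * (f (.F j) * f (.K i)) := by
            rw [hf.KF, mul_smul_comm, smul_mul_assoc]
        _ = f (.Kinv j) * (f (.E i) * f (.F j)) * f (.K i) := by
            rw [zpow_neg, ← hC.qi_zpow_symm, ← zpow_neg, ← hf.KinvE]
            simp only [mul_assoc]
    have h₂ : antipodeGen f (.F j) * antipodeGen f (.E i)
          - antipodeGen f (.E i) * antipodeGen f (.F j)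
        = -(f (.Kinv j) * (f (.E i) * f (.F j) - f (.F j) * f (.E i)) * f (.K i)) := by
      simp only [antipodeGen, neg_mul_neg, h₁, mul_sub, sub_mul, mul_assoc]
      abel
    rw [← MulOpposite.op_mul, ← MulOpposite.op_mul, ← MulOpposite.op_sub, h₂, hf.EF]
    split_ifs with hij
    · subst hij
      rw [← MulOpposite.op_sub, ← MulOpposite.op_smul]
      congr 1
      rw [mul_smul_comm, smul_mul_assoc, ← smul_neg, mul_sub, sub_mul, hf.KinvK, one_mul,
        mul_assoc, hf.KinvK, mul_one, neg_sub]
      rfl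
    · simp
  serreE i j h := by
    have hK : ∀ i j, -f (.K i) * f (.E j) = (qi d i ^ a i j) • (f (.E j) * -f (.K i)) := by
      intro i j
      rw [neg_mul, hf.KE, mul_neg, smul_neg]
    rw [serrePoly_op, antipodeGen, antipodeGen, ← mul_neg, ← mul_neg,
      serrePoly_twist (hK i i) (hK i j) (hC.qi_zpow_symm i j ▸ hK j i) (by simp [hf.KK i j])
        (hf.serreE i j h), smul_zero, MulOpposite.op_zero]
  serreF i j h := by
    have hS : ∀ i, antipodeGen f (.F i) = f (.F i) * -(qi d i ^ 2 • f (.Kinv i)) := by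
      intro i
      rw [antipodeGen, hf.KinvF, qi_zpow_self hC, mul_neg, mul_smul_comm]
    have hK : ∀ i j, -(qi d i ^ 2 • f (.Kinv i)) * f (.F j)
        = (qi d i ^ a i j) • (f (.F j) * -(qi d i ^ 2 • f (.Kinv i))) := by
      intro i j
      rw [neg_mul, smul_mul_assoc, hf.KinvF, mul_neg, smul_neg, mul_smul_comm, smul_comm]
    have hKK : -(qi d i ^ 2 • f (.Kinv i)) * -(qi d j ^ 2 • f (.Kinv j))
        = -(qi d j ^ 2 • f (.Kinv j)) * -(qi d i ^ 2 • f (.Kinv i)) := by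
      simp only [neg_mul_neg, smul_mul_assoc, mul_smul_comm, hf.KinvKinv i j]
      rw [smul_comm]
    rw [serrePoly_op, hS, hS,
      serrePoly_twist (hK i i) (hK i j) (hC.qi_zpow_symm i j ▸ hK j i) hKK
        (hf.serreF i j h), smul_zero, MulOpposite.op_zero]

lemma mul'_rTensor_comulGen (hf : QFamily a d r f) {S : B →ₗ[Kq] B} (h₁ : S 1 = 1)
    (hS : ∀ x, S (f x) = antipodeGen f x) (x : Gen n) :
    LinearMap.mul' Kq B (S.rTensor B (comulGen f x)) = algebraMap Kq B (counitGen x) := by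
  cases x <;>
    simp [comulGen, counitGen, hS, antipodeGen, h₁, mul_assoc, hf.KKinv, hf.KinvK, hf.gginv,
      hf.ginvg]

lemma mul'_lTensor_comulGen (hf : QFamily a d r f) {S : B →ₗ[Kq] B} (h₁ : S 1 = 1)
    (hS : ∀ x, S (f x) = antipodeGen f x) (x : Gen n) :
    LinearMap.mul' Kq B (S.lTensor B (comulGen f x)) = algebraMap Kq B (counitGen x) := by
  cases x <;>
    simp [comulGen, counitGen, hS, antipodeGen, h₁, ← mul_assoc, hf.KKinv, hf.KinvK, hf.gginv,
      hf.ginvg]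

end QFamily

namespace Uq

variable {a : Fin n → Fin n → ℤ} {d r : Fin n → ℕ}

/-- The comultiplication of `U_q`. -/
def comul (hC : CartanData n a d r) : Uq a d r →ₐ[Kq] Uq a d r ⊗[Kq] Uq a d r :=
  ((qFamily_gen a d r).comul hC).lift

/-- The counit of `U_q`. -/
def counit (a : Fin n → Fin n → ℤ) (d r : Fin n → ℕ) : Uq a d r →ₐ[Kq] Kq :=
  (QFamily.counit a d r).lift

/-- The antipode of `U_q`, as a homomorphism to the opposite algebra. -/
def antipodeOp (hC : CartanData n a d r) : Uq a d r →ₐ[Kq] (Uq a d r)ᵐᵒᵖ :=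
  ((qFamily_gen a d r).antipode hC).lift

/-- The antipode of `U_q`. -/
def antipode (hC : CartanData n a d r) : Uq a d r →ₗ[Kq] Uq a d r :=
  (MulOpposite.opLinearEquiv Kq).symm.toLinearMap ∘ₗ (antipodeOp hC).toLinearMap

lemma comul_gen (hC : CartanData n a d r) (x : Gen n) :
    comul hC (gen a d r x) = comulGen (gen a d r) x :=
  QFamily.lift_gen _ x

lemma counit_gen (x : Gen n) : counit a d r (gen a d r x) = counitGen x :=
  QFamily.lift_gen _ x

lemma antipode_gen (hC : CartanData n a d r) (x : Gen n) :
    antipode hC (gen a d r x) = antipodeGen (gen a d r) x :=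
  congrArg MulOpposite.unop (QFamily.lift_gen ((qFamily_gen a d r).antipode hC) x)

lemma antipode_mul (hC : CartanData n a d r) (x y : Uq a d r) :
    antipode hC (x * y) = antipode hC y * antipode hC x :=
  congrArg MulOpposite.unop (map_mul (antipodeOp hC) x y)

lemma antipode_one (hC : CartanData n a d r) : antipode hC 1 = 1 :=
  congrArg MulOpposite.unop (map_one (antipodeOp hC))

lemma antipode_algebraMap (hC : CartanData n a d r) (c : Kq) :
    antipode hC (algebraMap Kq _ c) = algebraMap Kq _ c := by
  rw [Algebra.algebraMap_eq_smul_one, map_smul, antipode_one]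

lemma comul_coassoc (hC : CartanData n a d r) (x : Uq a d r) :
    TensorProduct.assoc Kq _ _ _ ((comul hC).toLinearMap.rTensor _ (comul hC x))
      = (comul hC).toLinearMap.lTensor _ (comul hC x) := by
  have h : ((Algebra.TensorProduct.assoc Kq Kq Kq (Uq a d r) (Uq a d r) (Uq a d r)).toAlgHom.comp
        (Algebra.TensorProduct.map (comul hC) (AlgHom.id Kq (Uq a d r)))).comp (comul hC)
      = (Algebra.TensorProduct.map (AlgHom.id Kq (Uq a d r)) (comul hC)).comp (comul hC) := by
    refine algHom_ext fun x => ?_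
    cases x <;>
      simp [comul_gen, comulGen, TensorProduct.add_tmul, TensorProduct.tmul_add,
        Algebra.TensorProduct.one_def, add_assoc]
  exact DFunLike.congr_fun h x

lemma rTensor_counit_comul (hC : CartanData n a d r) (x : Uq a d r) :
    TensorProduct.lid Kq _ ((counit a d r).toLinearMap.rTensor _ (comul hC x)) = x := by
  have h : ((Algebra.TensorProduct.lid Kq (Uq a d r)).toAlgHom.comp
        (Algebra.TensorProduct.map (counit a d r) (AlgHom.id Kq (Uq a d r)))).comp (comul hC)
      = AlgHom.id Kq _ := by
    refine algHom_ext fun x => ?_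
    cases x <;> simp [comul_gen, comulGen, counit_gen, counitGen]
  exact DFunLike.congr_fun h x

lemma lTensor_counit_comul (hC : CartanData n a d r) (x : Uq a d r) :
    TensorProduct.rid Kq _ ((counit a d r).toLinearMap.lTensor _ (comul hC x)) = x := by
  have h : ((Algebra.TensorProduct.rid Kq Kq (Uq a d r)).toAlgHom.comp
        (Algebra.TensorProduct.map (AlgHom.id Kq (Uq a d r)) (counit a d r))).comp (comul hC)
      = AlgHom.id Kq _ := by
    refine algHom_ext fun x => ?_
    cases x <;> simp [comul_gen, comulGen, counit_gen, counitGen]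
  exact DFunLike.congr_fun h x

lemma mul_antipode_rTensor_comul (hC : CartanData n a d r) (x : Uq a d r) :
    LinearMap.mul' Kq _ ((antipode hC).rTensor _ (comul hC x))
      = algebraMap Kq _ (counit a d r x) := by
  induction x using induction with
  | hgen x =>
    rw [comul_gen, counit_gen]
    exact (qFamily_gen a d r).mul'_rTensor_comulGen (antipode_one hC) (antipode_gen hC) x
  | halg c =>
    rw [AlgHom.commutes, AlgHom.commutes, Algebra.TensorProduct.algebraMap_apply]
    simp [antipode_algebraMap]
  | hadd x y hx hy => simp only [map_add, hx, hy]
  | hmul x y hx hy =>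
    rw [map_mul, mul'_rTensor_mul (antipode_mul hC) hx, hy, map_mul, map_mul, Algebra.smul_def]

lemma mul_antipode_lTensor_comul (hC : CartanData n a d r) (x : Uq a d r) :
    LinearMap.mul' Kq _ ((antipode hC).lTensor _ (comul hC x))
      = algebraMap Kq _ (counit a d r x) := by
  induction x using induction with
  | hgen x =>
    rw [comul_gen, counit_gen]
    exact (qFamily_gen a d r).mul'_lTensor_comulGen (antipode_one hC) (antipode_gen hC) x
  | halg c =>
    rw [AlgHom.commutes, AlgHom.commutes, Algebra.TensorProduct.algebraMap_apply]
    simp [antipode_one]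
  | hadd x y hx hy => simp only [map_add, hx, hy]
  | hmul x y hx hy =>
    rw [map_mul, mul'_lTensor_mul (antipode_mul hC) hy, hx, map_mul, map_mul, Algebra.smul_def,
      Algebra.commutes]

lemma hopfProp (hC : CartanData n a d r) :
    HopfProp a d r (comul hC).toLinearMap (counit a d r).toLinearMap (antipode hC) := by
  refine ⟨comul_coassoc hC, rTensor_counit_comul hC, lTensor_counit_comul hC,
    map_one (comul hC), map_mul (comul hC), map_one (counit a d r), map_mul (counit a d r),
    mul_antipode_rTensor_comul hC, mul_antipode_lTensor_comul hC,
    fun i => comul_gen hC _, fun i => comul_gen hC _, fun i => comul_gen hC _, comul_gen hC _,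
    fun i => counit_gen _, fun i => counit_gen _, fun i => counit_gen _, counit_gen _,
    fun i => antipode_gen hC _, fun i => antipode_gen hC _, fun i => antipode_gen hC _,
    antipode_gen hC _⟩

end Uq

/-- The Hopf algebra structure is determined by its comultiplication and counit on generators. -/
lemma HopfProp.unique {a : Fin n → Fin n → ℤ} {d r : Fin n → ℕ}
    {Δ Δ' : Uq a d r →ₗ[Kq] (Uq a d r ⊗[Kq] Uq a d r)} {ε ε' : Uq a d r →ₗ[Kq] Kq}
    {S S' : Uq a d r →ₗ[Kq] Uq a d r} (h : HopfProp a d r Δ ε S)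
    (h' : HopfProp a d r Δ' ε' S') : Δ = Δ' ∧ ε = ε' ∧ S = S' := by
  obtain ⟨hΔ, hl, hr, hΔ1, hΔm, hε1, hεm, hS, -, hΔE, hΔF, hΔK, hΔg, hεE, hεF, hεK, hεg, -⟩ := h
  obtain ⟨-, -, -, hΔ1', hΔm', hε1', hεm', -, hT, hΔE', hΔF', hΔK', hΔg', hεE', hεF', hεK', hεg',
    -⟩ := h'
  have eΔ : Δ = Δ' := by
    have : (AlgHom.ofLinearMap Δ hΔ1 hΔm : Uq a d r →ₐ[Kq] Uq a d r ⊗[Kq] Uq a d r)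
        = AlgHom.ofLinearMap Δ' hΔ1' hΔm' := Uq.algHom_ext' (fun i => (hΔE i).trans (hΔE' i).symm)
      (fun i => (hΔF i).trans (hΔF' i).symm) (fun i => (hΔK i).trans (hΔK' i).symm)
      (hΔg.trans hΔg'.symm)
    exact congrArg AlgHom.toLinearMap this
  have eε : ε = ε' := by
    have : (AlgHom.ofLinearMap ε hε1 hεm : Uq a d r →ₐ[Kq] Kq)
        = AlgHom.ofLinearMap ε' hε1' hεm' := Uq.algHom_ext' (fun i => (hεE i).trans (hεE' i).symm)
      (fun i => (hεF i).trans (hεF' i).symm) (fun i => (hεK i).trans (hεK' i).symm)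
      (hεg.trans hεg'.symm)
    exact congrArg AlgHom.toLinearMap this
  subst eΔ eε
  exact ⟨rfl, rfl, antipode_unique hΔ hl hr hS hT⟩

/-- There is a unique Hopf algebra structure `(Δ, ε, S)` on `U_q` over `K` with the
prescribed values of the comultiplication, counit and antipode on the generators. -/
theorem exists_unique_Hopf {n : ℕ} (a : Fin n → Fin n → ℤ) (d r : Fin n → ℕ)
    (hC : CartanData n a d r) :
    ∃! ΔεS : (Uq a d r →ₗ[Kq] (Uq a d r ⊗[Kq] Uq a d r)) ×
        (Uq a d r →ₗ[Kq] Kq) × (Uq a d r →ₗ[Kq] Uq a d r),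
      HopfProp a d r ΔεS.1 ΔεS.2.1 ΔεS.2.2 := by
  refine ⟨((Uq.comul hC).toLinearMap, (Uq.counit a d r).toLinearMap, Uq.antipode hC),
    Uq.hopfProp hC, ?_⟩
  rintro ⟨Δ, ε, S⟩ h
  obtain ⟨h₁, h₂, h₃⟩ := HopfProp.unique h (Uq.hopfProp hC)
  exact Prod.ext h₁ (Prod.ext h₂ h₃)

end
end
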